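/- arXiv:1307.5969 — 9 statements merged into one kernel-verified Lean document; each statement's English description precedes it below -/
import Mathlib

section
/- Let C be a b-category, let X, Y ∈ C, and let n ≥ 2. Write X^{⊗n}⊗Y for the right-nested product X⊗(X⊗(⋯(X⊗Y)⋯)), and for 1 ≤ i ≤ n−1 define the automorphism b_i of X^{⊗n}⊗Y by b_i = 1_X^{⊗(i−1)} ⊗ β_{X,X,X^{⊗(n−i−1)}⊗Y} (so b_1 = β_{X,X,X^{⊗(n−2)}⊗Y} and b_{n−1} = 1⊗⋯⊗1⊗β_{X,X,Y}). Then the braid relations hold: b_i ∘ b_{i+1} ∘ b_i = b_{i+1} ∘ b_i ∘ b_{i+1} for 1 ≤ i ≤ n−2, and b_i ∘ b_j = b_j ∘ b_i whenever |i−j| > 1. If moreover C is symmetric (β_{Y,X,Z} ∘ β_{X,Y,Z} = id for all X, Y, Z), then additionally b_i ∘ b_i = id for all i. -/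
open CategoryTheory

universe v u

/-- A b-category: a category with a tensor product functor `⊗ : C × C → C` and a
natural family of isomorphisms `β_{X,Y,Z} : X⊗(Y⊗Z) ≅ Y⊗(X⊗Z)` satisfying the
permutohedron coherence. -/
structure BCat (C : Type u) [Category.{v} C] where
  tensorObj : C → C → C
  tensorHom : ∀ {X₁ Y₁ X₂ Y₂ : C}, (X₁ ⟶ Y₁) → (X₂ ⟶ Y₂) →
    (tensorObj X₁ X₂ ⟶ tensorObj Y₁ Y₂)
  tensorHom_id : ∀ (X Y : C), tensorHom (𝟙 X) (𝟙 Y) = 𝟙 (tensorObj X Y)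
  tensorHom_comp : ∀ {X₁ Y₁ Z₁ X₂ Y₂ Z₂ : C} (f₁ : X₁ ⟶ Y₁) (g₁ : Y₁ ⟶ Z₁)
    (f₂ : X₂ ⟶ Y₂) (g₂ : Y₂ ⟶ Z₂),
    tensorHom (f₁ ≫ g₁) (f₂ ≫ g₂) = tensorHom f₁ f₂ ≫ tensorHom g₁ g₂
  β : ∀ (X Y Z : C), tensorObj X (tensorObj Y Z) ≅ tensorObj Y (tensorObj X Z)
  β_natural : ∀ {X₁ Y₁ X₂ Y₂ X₃ Y₃ : C} (f : X₁ ⟶ Y₁) (g : X₂ ⟶ Y₂) (h : X₃ ⟶ Y₃),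
    tensorHom f (tensorHom g h) ≫ (β Y₁ Y₂ Y₃).hom
      = (β X₁ X₂ X₃).hom ≫ tensorHom g (tensorHom f h)
  b_coherence : ∀ (X Y Z W : C),
    tensorHom (𝟙 X) (β Y Z W).hom ≫ (β X Z (tensorObj Y W)).hom
        ≫ tensorHom (𝟙 Z) (β X Y W).hom
      = (β X Y (tensorObj Z W)).hom ≫ tensorHom (𝟙 Y) (β X Z W).hom
        ≫ (β Y Z (tensorObj X W)).hom

variable {C : Type u} [Category.{v} C]

/-- The right-nested tensor power `X^{⊗n} ⊗ Y`. -/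
def BCat.pow (B : BCat C) (X : C) : ℕ → C → C
  | 0, Y => Y
  | n + 1, Y => B.tensorObj X (B.pow X n Y)

/-- The braid group generator `b_{i+1} = 1^{⊗ i} ⊗ β_{X,X,X^{⊗(n-i)}⊗Y}`, an
automorphism of `X^{⊗(n+2)} ⊗ Y` (indices `i = 0, …, n` correspond to the
Coxeter generators `b_1, …, b_{n+1}` of the braid group `B_{n+2}`). -/
def BCat.bgen (B : BCat C) (X Y : C) : (n i : ℕ) → (B.pow X (n + 2) Y ⟶ B.pow X (n + 2) Y)
  | n, 0 => (B.β X X (B.pow X n Y)).hom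
  | 0, _ + 1 => 𝟙 _
  | n + 1, i + 1 => B.tensorHom (𝟙 X) (B.bgen X Y n i)

namespace BCat

theorem id_tensorHom_comp (B : BCat C) (X : C) {U V W : C} (f : U ⟶ V) (g : V ⟶ W) :
    B.tensorHom (𝟙 X) f ≫ B.tensorHom (𝟙 X) g = B.tensorHom (𝟙 X) (f ≫ g) := by
  rw [← B.tensorHom_comp, Category.comp_id]

theorem bgen_zero (B : BCat C) (X Y : C) (n : ℕ) :
    B.bgen X Y n 0 = (B.β X X (B.pow X n Y)).hom := by
  cases n <;> rfl

theorem bgen_braid (B : BCat C) (X Y : C) (n i : ℕ) (h : i + 1 ≤ n) :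
    B.bgen X Y n i ≫ B.bgen X Y n (i + 1) ≫ B.bgen X Y n i
      = B.bgen X Y n (i + 1) ≫ B.bgen X Y n i ≫ B.bgen X Y n (i + 1) := by
  induction i generalizing n with
  | zero =>
    obtain ⟨n, rfl⟩ := Nat.exists_eq_add_of_le' h
    have key := B.b_coherence X X X (B.pow X n Y)
    rw [← bgen_zero B X Y n] at key
    exact key.symm
  | succ i ih =>
    obtain ⟨n, rfl⟩ := Nat.exists_eq_add_of_le' (show 1 ≤ n by omega)
    have key := congrArg (B.tensorHom (𝟙 X)) (ih n (by omega))
    simp only [← id_tensorHom_comp] at key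
    exact key

theorem bgen_comm (B : BCat C) (X Y : C) (n i j : ℕ) (hij : i + 2 ≤ j) (hj : j ≤ n) :
    B.bgen X Y n i ≫ B.bgen X Y n j = B.bgen X Y n j ≫ B.bgen X Y n i := by
  induction i generalizing n j with
  | zero =>
    obtain ⟨j, rfl⟩ := Nat.exists_eq_add_of_le' hij
    obtain ⟨n, rfl⟩ := Nat.exists_eq_add_of_le' (hij.trans hj)
    exact (B.β_natural (𝟙 X) (𝟙 X) (B.bgen X Y n j)).symm
  | succ i ih =>
    obtain ⟨j, rfl⟩ := Nat.exists_eq_add_of_le' (show 1 ≤ j by omega)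
    obtain ⟨n, rfl⟩ := Nat.exists_eq_add_of_le' (show 1 ≤ n by omega)
    have key := congrArg (B.tensorHom (𝟙 X)) (ih n j (by omega) (by omega))
    simp only [← id_tensorHom_comp] at key
    exact key

theorem bgen_sq (B : BCat C) (X Y : C)
    (hβ : ∀ X' Y' Z' : C, (B.β X' Y' Z').hom ≫ (B.β Y' X' Z').hom = 𝟙 _)
    (n i : ℕ) (h : i ≤ n) : B.bgen X Y n i ≫ B.bgen X Y n i = 𝟙 _ := by
  induction i generalizing n with
  | zero =>
    rw [bgen_zero]
    exact hβ X X (B.pow X n Y)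
  | succ i ih =>
    obtain ⟨n, rfl⟩ := Nat.exists_eq_add_of_le' (show 1 ≤ n by omega)
    have key := congrArg (B.tensorHom (𝟙 X)) (ih n (by omega))
    rw [← id_tensorHom_comp, B.tensorHom_id] at key
    exact key

end BCat

/-- in a b-category the morphisms `b_i` on `X^{⊗n}⊗Y` satisfy the braid
relations (so they define a braid group action), and if the b-category is symmetric
they moreover square to the identity (so the action factors through the symmetric
group). -/
theorem bCat_braid_group_action (B : BCat C) (X Y : C) :
    (∀ (n i : ℕ), i + 1 ≤ n →
      B.bgen X Y n i ≫ B.bgen X Y n (i + 1) ≫ B.bgen X Y n i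
        = B.bgen X Y n (i + 1) ≫ B.bgen X Y n i ≫ B.bgen X Y n (i + 1)) ∧
    (∀ (n i j : ℕ), i + 2 ≤ j → j ≤ n →
      B.bgen X Y n i ≫ B.bgen X Y n j = B.bgen X Y n j ≫ B.bgen X Y n i) ∧
    ((∀ X' Y' Z' : C, (B.β X' Y' Z').hom ≫ (B.β Y' X' Z').hom = 𝟙 _) →
      ∀ (n i : ℕ), i ≤ n → B.bgen X Y n i ≫ B.bgen X Y n i = 𝟙 _) :=
  ⟨B.bgen_braid X Y, B.bgen_comm X Y, B.bgen_sq X Y⟩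
end

section
/- Let C be a unital b-category with induced braiding c. Then for all objects X, Y, Z the following hexagon commutes: β_{Y,Z,X} ∘ (1_Y ⊗ c_{X,Z}) ∘ β_{X,Y,Z} = (1_Z ⊗ c_{X,Y}) ∘ β_{X,Z,Y} ∘ (1_X ⊗ c_{Y,Z}) as morphisms X⊗(Y⊗Z) → Z⊗(Y⊗X). -/
open CategoryTheory

universe v u

/-- A unital b-category: a b-category with a unit object `I` and a natural family
of isomorphisms `ρ_X : X ⊗ I ≅ X`, required (below) to satisfy the unit
coherence `UnitCoh` and the mixed coherence `MixedCoh`. -/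
structure UBCat (C : Type u) [Category.{v} C] extends BCat C where
  unit : C
  ρ : ∀ X : C, tensorObj X unit ≅ X
  ρ_natural : ∀ {X Y : C} (f : X ⟶ Y),
    tensorHom f (𝟙 unit) ≫ (ρ Y).hom = (ρ X).hom ≫ f

variable {C : Type u} [Category.{v} C]

/-- Tensoring an isomorphism with an identity on the left, as an isomorphism. -/
def UBCat.idTensor (B : UBCat C) (X : C) {Y Y' : C} (e : Y ≅ Y') :
    B.tensorObj X Y ≅ B.tensorObj X Y' where
  hom := B.tensorHom (𝟙 X) e.hom
  inv := B.tensorHom (𝟙 X) e.inv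
  hom_inv_id := by rw [← B.tensorHom_comp]; simp [B.tensorHom_id]
  inv_hom_id := by rw [← B.tensorHom_comp]; simp [B.tensorHom_id]

/-- The induced braiding `c_{X,Y} = (1_Y ⊗ ρ_X) ∘ β_{X,Y,I} ∘ (1_X ⊗ ρ_Y⁻¹)`
of a unital b-category. -/
def UBCat.c (B : UBCat C) (X Y : C) : B.tensorObj X Y ≅ B.tensorObj Y X :=
  B.idTensor X (B.ρ Y).symm ≪≫ B.β X Y B.unit ≪≫ B.idTensor Y (B.ρ X)

/-- The unit coherence of a unital b-category:
`c_{X⊗Y,I} ∘ ρ_{X⊗Y}⁻¹ = β_{X,I,Y} ∘ (1_X ⊗ c_{Y,I}) ∘ (1_X ⊗ ρ_Y⁻¹)`. -/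
def UBCat.UnitCoh (B : UBCat C) : Prop :=
  ∀ X Y : C,
    (B.ρ (B.tensorObj X Y)).inv ≫ (B.c (B.tensorObj X Y) B.unit).hom
      = B.tensorHom (𝟙 X) (B.ρ Y).inv ≫ B.tensorHom (𝟙 X) (B.c Y B.unit).hom
          ≫ (B.β X B.unit Y).hom

/-- The mixed coherence of a unital b-category:
`(1_X ⊗ c_{Z⊗W,Y}) ∘ β_{Z⊗W,X,Y} ∘ c_{X⊗Y,Z⊗W}
  = (1_X ⊗ β_{Z,Y,W}) ∘ (1_X ⊗ (1_Z ⊗ c_{W,Y})) ∘ β_{Z,X,W⊗Y} ∘ (1_Z ⊗ β_{W,X,Y})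
      ∘ (1_Z ⊗ c_{X⊗Y,W}) ∘ β_{X⊗Y,Z,W}`. -/
def UBCat.MixedCoh (B : UBCat C) : Prop :=
  ∀ X Y Z W : C,
    (B.c (B.tensorObj X Y) (B.tensorObj Z W)).hom ≫ (B.β (B.tensorObj Z W) X Y).hom
        ≫ B.tensorHom (𝟙 X) (B.c (B.tensorObj Z W) Y).hom
      = (B.β (B.tensorObj X Y) Z W).hom
          ≫ B.tensorHom (𝟙 Z) (B.c (B.tensorObj X Y) W).hom
          ≫ B.tensorHom (𝟙 Z) (B.β W X Y).hom
          ≫ (B.β Z X (B.tensorObj W Y)).hom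
          ≫ B.tensorHom (𝟙 X) (B.tensorHom (𝟙 Z) (B.c W Y).hom)
          ≫ B.tensorHom (𝟙 X) (B.β Z Y W).hom

theorem UBCat.c_hom (B : UBCat C) (X Y : C) :
    (B.c X Y).hom = B.tensorHom (𝟙 X) (B.ρ Y).inv ≫ (B.β X Y B.unit).hom
      ≫ B.tensorHom (𝟙 Y) (B.ρ X).hom := rfl

theorem BCat.id_tensorHom_comp_s8 (B : BCat C) (W : C) {X Y Z : C} (f : X ⟶ Y) (g : Y ⟶ Z) :
    B.tensorHom (𝟙 W) (f ≫ g) = B.tensorHom (𝟙 W) f ≫ B.tensorHom (𝟙 W) g := by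
  rw [← B.tensorHom_comp, Category.comp_id]

theorem BCat.β_natural_right (B : BCat C) (X Y : C) {Z Z' : C} (h : Z ⟶ Z') :
    B.tensorHom (𝟙 X) (B.tensorHom (𝟙 Y) h) ≫ (B.β X Y Z').hom
      = (B.β X Y Z).hom ≫ B.tensorHom (𝟙 Y) (B.tensorHom (𝟙 X) h) :=
  B.β_natural _ _ _

/-- Lemma `brc`, diagram (brc1): in a unital b-category with induced
braiding `c`, the hexagon
`β_{Y,Z,X} ∘ (1_Y ⊗ c_{X,Z}) ∘ β_{X,Y,Z} = (1_Z ⊗ c_{X,Y}) ∘ β_{X,Z,Y} ∘ (1_X ⊗ c_{Y,Z})`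
commutes. -/
theorem ubcat_hexagon (B : UBCat C) (h₁ : B.UnitCoh) (h₂ : B.MixedCoh) (X Y Z : C) :
    (B.β X Y Z).hom ≫ B.tensorHom (𝟙 Y) (B.c X Z).hom ≫ (B.β Y Z X).hom
      = B.tensorHom (𝟙 X) (B.c Y Z).hom ≫ (B.β X Z Y).hom
          ≫ B.tensorHom (𝟙 Z) (B.c X Y).hom := by
  have key := congrArg (fun f => B.tensorHom (𝟙 X) (B.tensorHom (𝟙 Y) (B.ρ Z).inv) ≫ f
    ≫ B.tensorHom (𝟙 Z) (B.tensorHom (𝟙 Y) (B.ρ X).hom)) (B.b_coherence X Y Z B.unit)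
  have hYX : B.tensorHom (𝟙 Z) (B.tensorHom (𝟙 X) (B.ρ Y).hom)
      ≫ B.tensorHom (𝟙 Z) (B.tensorHom (𝟙 X) (B.ρ Y).inv) = 𝟙 _ := by
    simp only [← B.id_tensorHom_comp_s8, Iso.hom_inv_id, B.tensorHom_id]
  simp only [Category.assoc] at key
  have hr : (B.β X Y Z).hom ≫ B.tensorHom (𝟙 Y) (B.c X Z).hom ≫ (B.β Y Z X).hom
      = B.tensorHom (𝟙 X) (B.tensorHom (𝟙 Y) (B.ρ Z).inv) ≫ (B.β X Y _).hom
        ≫ B.tensorHom (𝟙 Y) (B.β X Z B.unit).hom ≫ (B.β Y Z _).hom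
        ≫ B.tensorHom (𝟙 Z) (B.tensorHom (𝟙 Y) (B.ρ X).hom) := by
    rw [← B.β_natural_right, reassoc_of% (B.β_natural_right X Y (B.ρ Z).inv), B.c_hom]
    simp only [B.id_tensorHom_comp_s8, Category.assoc]
  have hl : B.tensorHom (𝟙 X) (B.c Y Z).hom ≫ (B.β X Z Y).hom ≫ B.tensorHom (𝟙 Z) (B.c X Y).hom
      = B.tensorHom (𝟙 X) (B.tensorHom (𝟙 Y) (B.ρ Z).inv)
        ≫ B.tensorHom (𝟙 X) (B.β Y Z B.unit).hom ≫ (B.β X Z _).hom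
        ≫ B.tensorHom (𝟙 Z) (B.β X Y B.unit).hom
        ≫ B.tensorHom (𝟙 Z) (B.tensorHom (𝟙 Y) (B.ρ X).hom) := by
    simp only [B.c_hom, B.id_tensorHom_comp_s8, Category.assoc]
    rw [reassoc_of% (B.β_natural_right X Z (B.ρ Y).hom), reassoc_of% hYX]
  rw [hr, hl, key]
end

section
/- Let C be a unital b-category with induced braiding c. Then for all objects X, Y, Z the following commutes: c_{Y⊗Z,X} ∘ c_{X,Y⊗Z} = β_{Y,X,Z} ∘ (1_Y ⊗ c_{Z,X}) ∘ (1_Y ⊗ c_{X,Z}) ∘ β_{X,Y,Z} as endomorphisms of X⊗(Y⊗Z) (i.e. the double braiding of X past Y⊗Z equals the conjugate by β of the double braiding of X past Z). -/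
open CategoryTheory

universe v u

variable {C : Type u} [Category.{v} C]

namespace UBCat

variable (B : UBCat C)

theorem tensorHom_id_comp (X : C) {U V W : C} (f : U ⟶ V) (g : V ⟶ W) :
    B.tensorHom (𝟙 X) (f ≫ g) = B.tensorHom (𝟙 X) f ≫ B.tensorHom (𝟙 X) g := by
  rw [← B.tensorHom_comp, Category.id_comp]

theorem isIso_tensorHom {X X' Y Y' : C} (f : X ⟶ X') (g : Y ⟶ Y') [IsIso f] [IsIso g] :
    IsIso (B.tensorHom f g) :=
  ⟨B.tensorHom (inv f) (inv g), by
    simp [← B.tensorHom_comp, B.tensorHom_id]⟩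

theorem ρ_inv_natural {X Y : C} (f : X ⟶ Y) :
    f ≫ (B.ρ Y).inv = (B.ρ X).inv ≫ B.tensorHom f (𝟙 B.unit) := by
  rw [Iso.comp_inv_eq, Category.assoc, B.ρ_natural, Iso.inv_hom_id_assoc]

theorem c_hom_s9 (X Y : C) :
    (B.c X Y).hom = B.tensorHom (𝟙 X) (B.ρ Y).inv ≫ (B.β X Y B.unit).hom
      ≫ B.tensorHom (𝟙 Y) (B.ρ X).hom := rfl

theorem c_natural {X X' Y Y' : C} (f : X ⟶ X') (g : Y ⟶ Y') :
    B.tensorHom f g ≫ (B.c X' Y').hom = (B.c X Y).hom ≫ B.tensorHom g f := by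
  have hl : B.tensorHom f g ≫ B.tensorHom (𝟙 X') (B.ρ Y').inv
      = B.tensorHom (𝟙 X) (B.ρ Y).inv ≫ B.tensorHom f (B.tensorHom g (𝟙 B.unit)) := by
    rw [← B.tensorHom_comp, ← B.tensorHom_comp, B.ρ_inv_natural, Category.id_comp,
      Category.comp_id]
  have hr : B.tensorHom g (B.tensorHom f (𝟙 B.unit)) ≫ B.tensorHom (𝟙 Y') (B.ρ X').hom
      = B.tensorHom (𝟙 Y) (B.ρ X).hom ≫ B.tensorHom g f := by
    rw [← B.tensorHom_comp, ← B.tensorHom_comp, B.ρ_natural, Category.id_comp,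
      Category.comp_id]
  rw [c_hom_s9, c_hom_s9, reassoc_of% hl, reassoc_of% (B.β_natural f g (𝟙 B.unit)), hr]
  simp only [Category.assoc]

/-- The braiding of `V` past `X ⊗ I`, in terms of the braiding of `V` past `X`. -/
theorem β_unit (V X : C) :
    (B.β V X B.unit).hom
      = B.tensorHom (𝟙 V) (B.ρ X).hom ≫ (B.c V X).hom ≫ B.tensorHom (𝟙 X) (B.ρ V).inv := by
  rw [c_hom_s9]
  simp only [Category.assoc]
  rw [← B.tensorHom_id_comp, Iso.hom_inv_id, B.tensorHom_id, Category.comp_id,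
    ← Category.assoc, ← B.tensorHom_id_comp, Iso.hom_inv_id, B.tensorHom_id, Category.id_comp]

theorem c_comp_β_comp_c_unit (X V : C) :
    (B.c (B.tensorObj X B.unit) V).hom ≫ (B.β V X B.unit).hom
        ≫ B.tensorHom (𝟙 X) (B.c V B.unit).hom
      = B.tensorHom (B.ρ X).hom (𝟙 V) ≫ (B.c X V).hom ≫ (B.c V X).hom
          ≫ B.tensorHom (𝟙 X) ((B.ρ V).inv ≫ (B.c V B.unit).hom) := by
  rw [β_unit, tensorHom_id_comp, reassoc_of% (B.c_natural (B.ρ X).hom (𝟙 V))]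
  simp only [Category.assoc]

end UBCat

/-- diagram (ubc2): in a unital b-category with induced braiding `c`,
the double braiding of `X` past `Y⊗Z` equals the conjugate by `β` of the double
braiding of `X` past `Z`:
`c_{Y⊗Z,X} ∘ c_{X,Y⊗Z} = β_{Y,X,Z} ∘ (1_Y ⊗ c_{Z,X}) ∘ (1_Y ⊗ c_{X,Z}) ∘ β_{X,Y,Z}`. -/
theorem ubcat_double_braiding (B : UBCat C) (h₁ : B.UnitCoh) (h₂ : B.MixedCoh)
    (X Y Z : C) :
    (B.c X (B.tensorObj Y Z)).hom ≫ (B.c (B.tensorObj Y Z) X).hom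
      = (B.β X Y Z).hom ≫ B.tensorHom (𝟙 Y) (B.c X Z).hom
          ≫ B.tensorHom (𝟙 Y) (B.c Z X).hom ≫ (B.β Y X Z).hom := by
  have hm := h₂ X B.unit Y Z
  -- Group the right-hand side so that the composite of `c_comp_β_comp_c_unit` appears.
  have hβ : (B.β Y X (B.tensorObj Z B.unit)).hom
        ≫ B.tensorHom (𝟙 X) (B.tensorHom (𝟙 Y) (B.c Z B.unit).hom)
      = B.tensorHom (𝟙 Y) (B.tensorHom (𝟙 X) (B.c Z B.unit).hom)
        ≫ (B.β Y X (B.tensorObj B.unit Z)).hom := (B.β_natural _ _ _).symm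
  have hT := congrArg (B.tensorHom (𝟙 Y)) (B.c_comp_β_comp_c_unit X Z)
  simp only [B.tensorHom_id_comp] at hT
  have hρ := B.β_natural (B.ρ X).hom (𝟙 Y) (𝟙 Z)
  rw [B.tensorHom_id] at hρ
  have hu := congrArg (B.tensorHom (𝟙 X)) (h₁ Y Z)
  simp only [B.tensorHom_id_comp] at hu
  have hn (W W' : C) (f : W ⟶ W') := B.β_natural (𝟙 Y) (𝟙 X) f
  rw [B.c_comp_β_comp_c_unit, B.tensorHom_id_comp, reassoc_of% hβ, reassoc_of% hT,
    ← reassoc_of% hρ, reassoc_of% (hn _ _ (B.c Z B.unit).hom),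
    reassoc_of% (hn _ _ (B.ρ Z).inv), ← hu] at hm
  have := B.isIso_tensorHom (B.ρ X).hom (𝟙 (B.tensorObj Y Z))
  have := B.isIso_tensorHom (𝟙 X)
    ((B.ρ (B.tensorObj Y Z)).inv ≫ (B.c (B.tensorObj Y Z) B.unit).hom)
  rw [← cancel_epi (B.tensorHom (B.ρ X).hom (𝟙 (B.tensorObj Y Z))),
    ← cancel_mono (B.tensorHom (𝟙 X)
      ((B.ρ (B.tensorObj Y Z)).inv ≫ (B.c (B.tensorObj Y Z) B.unit).hom))]
  simpa only [B.tensorHom_id_comp, Category.assoc] using hm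
end

section
/- Let C be a unital b-category with induced braiding c. Then for all objects X, Y, Z the two composites c_{Z,X⊗Y} ∘ β_{Z,X,Y}^{-1} ∘ (1_X ⊗ c_{Z,Y}^{-1}) and c_{X⊗Y,Z}^{-1} ∘ β_{X,Z,Y} ∘ (1_X ⊗ c_{Y,Z}) from X⊗(Y⊗Z) to (X⊗Y)⊗Z coincide (giving a well-defined associator α_{X,Y,Z}). -/
open CategoryTheory

universe v u

variable {C : Type u} [Category.{v} C]

namespace UBCat

theorem id_tensorHom_comp (B : UBCat C) (X : C) {P Q R : C} (f : P ⟶ Q) (g : Q ⟶ R) :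
    B.tensorHom (𝟙 X) (f ≫ g) = B.tensorHom (𝟙 X) f ≫ B.tensorHom (𝟙 X) g := by
  simpa using B.tensorHom_comp (𝟙 X) (𝟙 X) f g

theorem β_hom_id_tensorHom_ρ (B : UBCat C) (X Y : C) :
    (B.β X Y B.unit).hom ≫ B.tensorHom (𝟙 Y) (B.ρ X).hom
      = B.tensorHom (𝟙 X) (B.ρ Y).hom ≫ (B.c X Y).hom := by
  simp only [c, Iso.trans_hom, idTensor, Iso.symm_hom]
  rw [← Category.assoc (B.tensorHom _ _), ← id_tensorHom_comp, Iso.hom_inv_id, B.tensorHom_id,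
    Category.id_comp]

theorem c_naturality (B : UBCat C) {X X' Y Y' : C} (f : X ⟶ X') (g : Y ⟶ Y') :
    B.tensorHom f g ≫ (B.c X' Y').hom = (B.c X Y).hom ≫ B.tensorHom g f := by
  rw [← cancel_epi (B.idTensor X (B.ρ Y)).hom]
  have hβ := B.β_natural f g (𝟙 B.unit)
  have hX := β_hom_id_tensorHom_ρ B X Y
  have hX' := β_hom_id_tensorHom_ρ B X' Y'
  have hf : B.tensorHom (𝟙 X) (B.ρ Y).hom ≫ B.tensorHom f g
      = B.tensorHom f (B.tensorHom g (𝟙 B.unit)) ≫ B.tensorHom (𝟙 X') (B.ρ Y').hom := by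
    rw [← B.tensorHom_comp, ← B.tensorHom_comp, B.ρ_natural, Category.id_comp, Category.comp_id]
  have hg : B.tensorHom (𝟙 Y) (B.ρ X).hom ≫ B.tensorHom g f
      = B.tensorHom g (B.tensorHom f (𝟙 B.unit)) ≫ B.tensorHom (𝟙 Y') (B.ρ X').hom := by
    rw [← B.tensorHom_comp, ← B.tensorHom_comp, B.ρ_natural, Category.id_comp, Category.comp_id]
  simp only [idTensor]
  rw [← reassoc_of% hX, hg, reassoc_of% hf, ← hX', reassoc_of% hβ]

/-- The inverse left unitor `X ≅ I ⊗ X` induced by the braiding. -/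
def leftUnit (B : UBCat C) (X : C) : X ≅ B.tensorObj B.unit X :=
  (B.ρ X).symm ≪≫ B.c X B.unit

theorem c_unit_hom (B : UBCat C) (X : C) :
    (B.c X B.unit).hom = (B.ρ X).hom ≫ (B.leftUnit X).hom := by
  simp [leftUnit]

theorem leftUnit_tensorObj (B : UBCat C) (h : B.UnitCoh) (X Y : C) :
    (B.leftUnit (B.tensorObj X Y)).hom
      = B.tensorHom (𝟙 X) (B.leftUnit Y).hom ≫ (B.β X B.unit Y).hom := by
  simpa [leftUnit, id_tensorHom_comp] using h X Y

theorem β_hom_id_tensorHom_c_unit (B : UBCat C) (X Y : C) :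
    (B.β X Y B.unit).hom ≫ B.tensorHom (𝟙 Y) (B.c X B.unit).hom
      = B.tensorHom (𝟙 X) (B.ρ Y).hom ≫ (B.c X Y).hom
        ≫ B.tensorHom (𝟙 Y) (B.leftUnit X).hom := by
  rw [c_unit_hom, id_tensorHom_comp, reassoc_of% β_hom_id_tensorHom_ρ B X Y]

/-- The double braiding of `X` with `Y ⊗ Z` passes `X` across `Y`, braids it twice with `Z`,
and brings it back. -/
theorem c_hom_comp_c_hom (B : UBCat C) (h₁ : B.UnitCoh) (h₂ : B.MixedCoh) (X Y Z : C) :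
    (B.c X (B.tensorObj Y Z)).hom ≫ (B.c (B.tensorObj Y Z) X).hom
      = (B.β X Y Z).hom ≫ B.tensorHom (𝟙 Y) (B.c X Z).hom
        ≫ B.tensorHom (𝟙 Y) (B.c Z X).hom ≫ (B.β Y X Z).hom := by
  have hρ : B.tensorHom (B.ρ X).inv (𝟙 (B.tensorObj Y Z))
      ≫ B.tensorHom (B.ρ X).hom (𝟙 (B.tensorObj Y Z)) = 𝟙 _ := by
    rw [← B.tensorHom_comp, Iso.inv_hom_id, Category.comp_id, B.tensorHom_id]
  have : Epi (B.tensorHom (B.ρ X).hom (𝟙 (B.tensorObj Y Z))) :=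
    epi_of_epi_fac hρ
  rw [← cancel_epi (B.tensorHom (B.ρ X).hom (𝟙 (B.tensorObj Y Z))),
    ← cancel_mono (B.idTensor X (B.leftUnit (B.tensorObj Y Z))).hom]
  have hYZ := β_hom_id_tensorHom_c_unit B (B.tensorObj Y Z) X
  have hm := h₂ X B.unit Y Z
  have hc := c_naturality B (B.ρ X).hom (𝟙 (B.tensorObj Y Z))
  have hcZ := c_naturality B (B.ρ X).hom (𝟙 Z)
  have hβ := B.β_natural (B.ρ X).hom (𝟙 Y) (𝟙 Z)
  rw [B.tensorHom_id] at hβ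
  have hl : B.tensorHom (𝟙 X) (B.leftUnit (B.tensorObj Y Z)).hom =
      B.tensorHom (𝟙 X) (B.tensorHom (𝟙 Y) (B.leftUnit Z).hom)
        ≫ B.tensorHom (𝟙 X) (B.β Y B.unit Z).hom := by
    rw [leftUnit_tensorObj B h₁, id_tensorHom_comp]
  have hcu : B.tensorHom (𝟙 Y) (B.β Z X B.unit).hom ≫ (B.β Y X (B.tensorObj Z B.unit)).hom
      ≫ B.tensorHom (𝟙 X) (B.tensorHom (𝟙 Y) (B.c Z B.unit).hom)
      = B.tensorHom (𝟙 Y) (B.tensorHom (𝟙 Z) (B.ρ X).hom) ≫ B.tensorHom (𝟙 Y) (B.c Z X).hom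
        ≫ (B.β Y X Z).hom ≫ B.tensorHom (𝟙 X) (B.tensorHom (𝟙 Y) (B.leftUnit Z).hom) := by
    rw [← B.β_natural, ← B.β_natural, ← Category.assoc, ← id_tensorHom_comp,
      β_hom_id_tensorHom_c_unit]
    simp only [id_tensorHom_comp, Category.assoc]
  rw [hYZ, reassoc_of% hcu] at hm
  have hcZ' : B.tensorHom (𝟙 Y) (B.c (B.tensorObj X B.unit) Z).hom
      ≫ B.tensorHom (𝟙 Y) (B.tensorHom (𝟙 Z) (B.ρ X).hom)
      = B.tensorHom (𝟙 Y) (B.tensorHom (B.ρ X).hom (𝟙 Z)) ≫ B.tensorHom (𝟙 Y) (B.c X Z).hom := by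
    rw [← id_tensorHom_comp, ← id_tensorHom_comp, hcZ]
  rw [reassoc_of% hcZ', ← reassoc_of% hβ, ← reassoc_of% hc, ← hl] at hm
  simpa only [idTensor, Category.assoc] using hm

end UBCat

/-- in a unital b-category with induced braiding `c`, the two
composites `c_{Z,X⊗Y} ∘ β_{Z,X,Y}⁻¹ ∘ (1_X ⊗ c_{Z,Y}⁻¹)` and
`c_{X⊗Y,Z}⁻¹ ∘ β_{X,Z,Y} ∘ (1_X ⊗ c_{Y,Z})` from `X⊗(Y⊗Z)` to `(X⊗Y)⊗Z`
coincide (giving a well-defined associator `α_{X,Y,Z}`). -/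
theorem ubcat_associator_well_defined (B : UBCat C) (h₁ : B.UnitCoh)
    (h₂ : B.MixedCoh) (X Y Z : C) :
    B.tensorHom (𝟙 X) (B.c Z Y).inv ≫ (B.β Z X Y).inv
        ≫ (B.c Z (B.tensorObj X Y)).hom
      = B.tensorHom (𝟙 X) (B.c Y Z).hom ≫ (B.β X Z Y).hom
          ≫ (B.c (B.tensorObj X Y) Z).inv := by
  have h := UBCat.c_hom_comp_c_hom B h₁ h₂ Z X Y
  rw [← cancel_epi (B.idTensor X (B.c Z Y)).hom, ← cancel_epi (B.β Z X Y).hom,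
    ← cancel_mono (B.c (B.tensorObj X Y) Z).hom]
  have hc : B.tensorHom (𝟙 X) (B.c Z Y).hom ≫ B.tensorHom (𝟙 X) (B.c Z Y).inv = 𝟙 _ :=
    (B.idTensor X (B.c Z Y)).hom_inv_id
  simp only [UBCat.idTensor, Category.assoc, Iso.inv_hom_id, Category.comp_id, reassoc_of% hc,
    Iso.hom_inv_id_assoc]
  exact h
end

section
/- Let C and D be unital b-categories with induced braidings c, and let F : C → D be a unital b-functor, i.e. F is equipped with natural isomorphisms F_{X,Y} : F(X⊗Y) → F(X)⊗F(Y) satisfying β_{F(X),F(Y),F(Z)} ∘ (1 ⊗ F_{Y,Z}) ∘ F_{X,Y⊗Z} = (1 ⊗ F_{X,Z}) ∘ F_{Y,X⊗Z} ∘ F(β_{X,Y,Z}) for all X, Y, Z, and an isomorphism φ : F(I) → I such that ρ_{F(X)} ∘ (1_{F(X)} ⊗ φ) ∘ F_{X,I} = F(ρ_X) for all X. Then F is compatible with the induced braidings: c_{F(X),F(Y)} ∘ F_{X,Y} = F_{Y,X} ∘ F(c_{X,Y}) for all objects X, Y of C. -/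
open CategoryTheory

universe v u

variable {C : Type u} [Category.{v} C]

universe v' u'

/-- Lemma `ubf1`: a unital b-functor between unital b-categories is
compatible with the induced braidings: `c_{F X,F Y} ∘ F_{X,Y} = F_{Y,X} ∘ F(c_{X,Y})`. -/
theorem unital_bFunctor_braided {D : Type u'} [Category.{v'} D]
    (B : UBCat C) (h₁ : B.UnitCoh) (h₂ : B.MixedCoh)
    (B' : UBCat D) (h₁' : B'.UnitCoh) (h₂' : B'.MixedCoh)
    (F : C ⥤ D)
    -- the b-functor structure isomorphisms `F_{X,Y} : F(X⊗Y) ≅ F(X)⊗F(Y)` …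
    (Fm : ∀ X Y : C, F.obj (B.tensorObj X Y) ≅ B'.tensorObj (F.obj X) (F.obj Y))
    -- … natural in `X,Y` …
    (Fm_natural : ∀ {X X' Y Y' : C} (f : X ⟶ X') (g : Y ⟶ Y'),
      F.map (B.tensorHom f g) ≫ (Fm X' Y').hom
        = (Fm X Y).hom ≫ B'.tensorHom (F.map f) (F.map g))
    -- … satisfying the b-functor coherence …
    (Fm_coh : ∀ X Y Z : C,
      (Fm X (B.tensorObj Y Z)).hom
          ≫ B'.tensorHom (𝟙 (F.obj X)) (Fm Y Z).hom
          ≫ (B'.β (F.obj X) (F.obj Y) (F.obj Z)).hom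
        = F.map (B.β X Y Z).hom ≫ (Fm Y (B.tensorObj X Z)).hom
            ≫ B'.tensorHom (𝟙 (F.obj Y)) (Fm X Z).hom)
    -- … together with a unit isomorphism `φ : F(I) ≅ I` such that
    -- `ρ_{F X} ∘ (1 ⊗ φ) ∘ F_{X,I} = F(ρ_X)`.
    (φ : F.obj B.unit ≅ B'.unit)
    (Fφ_coh : ∀ X : C,
      (Fm X B.unit).hom ≫ B'.tensorHom (𝟙 (F.obj X)) φ.hom
          ≫ (B'.ρ (F.obj X)).hom
        = F.map (B.ρ X).hom) :
    ∀ X Y : C,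
      (Fm X Y).hom ≫ (B'.c (F.obj X) (F.obj Y)).hom
        = F.map (B.c X Y).hom ≫ (Fm Y X).hom := by
  intro X Y
  have inv_coh : F.map (B.ρ Y).inv ≫ (Fm Y B.unit).hom ≫ B'.tensorHom (𝟙 (F.obj Y)) φ.hom
      = (B'.ρ (F.obj Y)).inv := by
    rw [← cancel_mono (B'.ρ (F.obj Y)).hom, Category.assoc, Category.assoc, Fφ_coh, ← F.map_comp,
      Iso.inv_hom_id, Iso.inv_hom_id, F.map_id]
  have idTensor_comp : ∀ {A P Q R : D} (f : P ⟶ Q) (g : Q ⟶ R),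
      B'.tensorHom (𝟙 A) (f ≫ g) = B'.tensorHom (𝟙 A) f ≫ B'.tensorHom (𝟙 A) g := by
    intro A P Q R f g
    rw [← B'.tensorHom_comp, Category.id_comp]
  have left := Fm_natural (𝟙 X) (B.ρ Y).inv
  have right := Fm_natural (𝟙 Y) (B.ρ X).hom
  rw [F.map_id] at left right
  have slide := B'.β_natural (𝟙 (F.obj X)) (𝟙 (F.obj Y)) φ.hom
  simp only [UBCat.c, UBCat.idTensor, Iso.trans_hom, Iso.symm_hom, F.map_comp, Category.assoc]
  rw [right, ← Fφ_coh X, ← inv_coh]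
  simp only [idTensor_comp, Category.assoc]
  rw [← reassoc_of% (Fm_coh X Y B.unit), reassoc_of% left, reassoc_of% slide]
end

section
/- Let A be a b-magma and B an abelian group. For c : A^n → B and 1 ≤ i ≤ n, define δ_i(c) : A^{n+1} → B by δ_i(c)(x_1,…,x_n,x) = c(x_1,…,x̂_i,…,x_n, x_i x) − c(x_1,…,x̂_i,…,x_n, x), where x̂_i means that x_i is omitted. Then for all 1 ≤ i ≤ j ≤ n and all c : A^n → B, one has δ_i(δ_j(c)) = δ_{j+1}(δ_i(c)) as maps A^{n+2} → B. -/
/-- The b-cohomology face map `δ_i(c)(x_1,…,x_n,x) =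
c(x_1,…,x̂_i,…,x_n, x_i·x) − c(x_1,…,x̂_i,…,x_n, x)` (0-indexed: `i : Fin (n+1)`
is the paper's `i+1`, a tuple `v : Fin (n+2) → A` encodes `(x_1,…,x_{n+1}, x)`
with `x = v (Fin.last _)`). -/
def bDelta {A B : Type*} [Mul A] [AddCommGroup B] {n : ℕ}
    (i : Fin (n + 1)) (c : (Fin (n + 1) → A) → B) : (Fin (n + 2) → A) → B :=
  fun v =>
    c (Fin.snoc (i.removeNth (Fin.init v)) (Fin.init v i * v (Fin.last (n + 1))))
      - c (Fin.snoc (i.removeNth (Fin.init v)) (v (Fin.last (n + 1))))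

/-- Removing the entries `i` and `j + 1` of a tuple, where `i ≤ j`, in either order gives
the same tuple. -/
theorem Fin.removeNth_castSucc_comm {A : Type*} {n : ℕ} {i j : Fin (n + 1)} (hij : i ≤ j)
    (u : Fin (n + 2) → A) :
    j.removeNth (i.castSucc.removeNth u) = i.removeNth (j.succ.removeNth u) := by
  funext k
  simp only [Fin.removeNth]
  congr 1
  ext
  simp only [Fin.succAbove, Fin.lt_def, Fin.le_def] at *
  grind

/-- for a b-magma `A` and abelian group `B`, the face maps satisfy
the simplicial-type identity `δ_i ∘ δ_j = δ_{j+1} ∘ δ_i` for `i ≤ j`. -/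
theorem bDelta_comm {A B : Type*} [Mul A] [AddCommGroup B]
    (hb : ∀ x y z : A, x * (y * z) = y * (x * z)) {n : ℕ}
    (i j : Fin (n + 1)) (hij : i ≤ j) (c : (Fin (n + 1) → A) → B) :
    bDelta i.castSucc (bDelta j c) = bDelta j.succ (bDelta i c) := by
  have hi : i.castSucc.succAbove j = j.succ :=
    Fin.succAbove_of_le_castSucc _ _ (Fin.castSucc_le_castSucc_iff.mpr hij)
  have hj : j.succ.succAbove i = i.castSucc :=
    Fin.succAbove_of_castSucc_lt _ _ (Fin.castSucc_lt_succ_iff.mpr hij)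
  funext w
  simp only [bDelta, Fin.init_snoc, Fin.snoc_last, Fin.removeNth_castSucc_comm hij]
  simp only [Fin.removeNth_apply, hi, hj, hb (Fin.init w j.succ)]
  abel
end

section
/- Let A be a b-magma and B an abelian group. For n ≥ 2 define d : C^n(A,B) → C^{n+1}(A,B) by d(c)(x_1,…,x_n,x) = Σ_{i=1}^n (−1)^i [c(x_1,…,x̂_i,…,x_n, x_i x) − c(x_1,…,x̂_i,…,x_n, x)], and define d : C^1(A,B) → C^2(A,B) by d(p)(x,y) = p(x) − p(xy) + p(y). Then d ∘ d = 0: for every n ≥ 2 and every c ∈ C^n(A,B) one has d(d(c)) = 0, and for every p ∈ C^1(A,B) one has d(d(p)) = 0. -/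
/-- The b-cohomology differential `d(c) = Σ_{i=1}^n (−1)^i δ_i(c)`
on cochains in `n+1 ≥ 2` variables (the sign `(−1)^{i+1}` below corresponds to
the paper's `(−1)^i` with its 1-based index `i`). -/
def bDiff {A B : Type*} [Mul A] [AddCommGroup B] {n : ℕ}
    (c : (Fin (n + 1) → A) → B) : (Fin (n + 2) → A) → B :=
  fun v => ∑ i : Fin (n + 1), ((-1 : ℤ) ^ ((i : ℕ) + 1)) • bDelta i c v

/-- The degree-one differential `d(p)(x,y) = p(x) − p(xy) + p(y)`. -/
def bDiffOne {A B : Type*} [Mul A] [AddCommGroup B] (p : A → B) : (Fin 2 → A) → B :=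
  fun v => p (v 0) - p (v 0 * v 1) + p (v 1)

theorem Fin.sum_sum_eq_zero_of_succAbove_predAbove {B : Type*} [AddCommGroup B] {n : ℕ}
    (f : Fin (n + 2) → Fin (n + 1) → B)
    (hf : ∀ i j, f i j + f (i.succAbove j) (j.predAbove i) = 0) :
    ∑ i, ∑ j, f i j = 0 := by
  rw [← Fintype.sum_prod_type']
  refine Finset.sum_involution (fun p _ => (p.1.succAbove p.2, p.2.predAbove p.1))
    (fun p _ => hf p.1 p.2) (fun p _ _ h => ?_) (fun p _ => Finset.mem_univ _) (fun p _ => ?_)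
  · exact Fin.succAbove_ne p.1 p.2 (congrArg Prod.fst h)
  · ext1
    · exact Fin.succAbove_succAbove_predAbove p.1 p.2
    · exact Fin.predAbove_predAbove_succAbove p.1 p.2

theorem bDiff_bDiff {A B : Type*} [Mul A] [AddCommGroup B]
    (hb : ∀ x y z : A, x * (y * z) = y * (x * z)) {n : ℕ} (c : (Fin (n + 1) → A) → B) :
    bDiff (bDiff c) = 0 := by
  funext v
  simp only [bDiff, bDelta, Fin.init_snoc, Fin.snoc_last, ← Finset.sum_sub_distrib,
    Finset.smul_sum, smul_smul, Pi.zero_apply, ← smul_sub]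
  refine Fin.sum_sum_eq_zero_of_succAbove_predAbove _ fun i j => ?_
  rw [← Fin.removeNth_removeNth_eq_swap (Fin.init v) j i]
  have hsign : (-1 : ℤ) ^ ((i.succAbove j : ℕ) + 1) * (-1) ^ ((j.predAbove i : ℕ) + 1)
      = -((-1) ^ ((i : ℕ) + 1) * (-1) ^ ((j : ℕ) + 1)) := by
    have := Fin.neg_one_pow_succAbove_add_predAbove (R := ℤ) i j
    simp only [pow_add, pow_one] at this ⊢
    linarith
  simp only [hsign, Fin.removeNth, Fin.succAbove_succAbove_predAbove]
  rw [hb (Fin.init v i), neg_smul, ← sub_eq_add_neg, ← smul_sub]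
  convert smul_zero _ using 2
  abel

/-- for a b-magma `A` and abelian group `B`, the b-cohomology
differential squares to zero: `d ∘ d = 0` on `C^n(A,B)` for every `n ≥ 2`
(cochains in `n+2` variables below), and `d(d(p)) = 0` for `p ∈ C^1(A,B)`. -/
theorem bDiff_squared_zero {A B : Type*} [Mul A] [AddCommGroup B]
    (hb : ∀ x y z : A, x * (y * z) = y * (x * z)) :
    (∀ (n : ℕ) (c : (Fin (n + 2) → A) → B), bDiff (bDiff c) = 0) ∧
    (∀ p : A → B, bDiff (bDiffOne p) = 0) := by
  refine ⟨fun n c => bDiff_bDiff hb c, fun p => ?_⟩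
  funext v
  simp [bDiff, bDelta, bDiffOne, Fin.sum_univ_two, Fin.snoc, Fin.init, Fin.removeNth]
  rw [hb (v 1)]
  abel
end

section
/- Let k be a field, M a k-vector space, and B : M⊗M → M⊗M a k-linear automorphism. For k-vector spaces U_1, U_2, U_3, define β_{U_1,U_2,U_3} : U_1⊗M⊗U_2⊗M⊗U_3 → U_2⊗M⊗U_1⊗M⊗U_3 as the composite of the transposition exchanging the tensor factors U_1 and U_2 with B applied to the two M factors (i.e. β = B_{24} ∘ t_{13}, where subscripts refer to the positions of the tensor factors). Then the family β satisfies the b-category coherence — for all vector spaces X, Y, Z, W, (1 ⊗ β_{X,Y,W}) ∘ β_{X,Z,Y⊗_M W} ∘ (1 ⊗ β_{Y,Z,W}) = β_{Y,Z,X⊗_M W} ∘ (1 ⊗ β_{X,Z,W}) ∘ β_{X,Y,Z⊗_M W} — if and only if B satisfies the hexagon (braid) equation B_{12} B_{23} B_{12} = B_{23} B_{12} B_{23} on M⊗M⊗M, where B_{12} = B⊗1_M and B_{23} = 1_M⊗B. -/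
open TensorProduct

universe u

/-- Insertion map: for fixed `u₁, u₂, u₃`, the linear map
`M ⊗ M →ₗ U₂ ⊗ (M ⊗ (U₁ ⊗ (M ⊗ U₃)))` sending `m₁ ⊗ m₂` to
`u₂ ⊗ m₁ ⊗ u₁ ⊗ m₂ ⊗ u₃`.  (Used to express the b-structure `β = B₂₄ ∘ t₁₃` on
`(Vect_k, ⊗_M)` via pure tensors.) -/
noncomputable def insTensor (k : Type u) [Field k] (M : Type u) [AddCommGroup M]
    [Module k M] {U₁ U₂ U₃ : Type u}
    [AddCommGroup U₁] [AddCommGroup U₂] [AddCommGroup U₃]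
    [Module k U₁] [Module k U₂] [Module k U₃] (u₁ : U₁) (u₂ : U₂) (u₃ : U₃) :
    M ⊗[k] M →ₗ[k] U₂ ⊗[k] (M ⊗[k] (U₁ ⊗[k] (M ⊗[k] U₃))) :=
  (TensorProduct.mk k U₂ (M ⊗[k] (U₁ ⊗[k] (M ⊗[k] U₃))) u₂)
    ∘ₗ LinearMap.lTensor M (TensorProduct.mk k U₁ (M ⊗[k] U₃) u₁)
    ∘ₗ LinearMap.lTensor M ((TensorProduct.mk k M U₃).flip u₃)

section Insertion

variable {k : Type u} [Field k] {M : Type u} [AddCommGroup M] [Module k M]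
  {U₁ U₂ U₃ U₄ : Type u} [AddCommGroup U₁] [AddCommGroup U₂] [AddCommGroup U₃] [AddCommGroup U₄]
  [Module k U₁] [Module k U₂] [Module k U₃] [Module k U₄]

@[simp]
theorem insTensor_tmul (u₁ : U₁) (u₂ : U₂) (u₃ : U₃) (m₁ m₂ : M) :
    insTensor k M u₁ u₂ u₃ (m₁ ⊗ₜ m₂) = u₂ ⊗ₜ (m₁ ⊗ₜ (u₁ ⊗ₜ (m₂ ⊗ₜ u₃))) := by
  simp [insTensor]

theorem insTensor_one_injective : Function.Injective (insTensor k M (1 : k) (1 : k) (1 : k)) := by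
  let r : k ⊗[k] (M ⊗[k] (k ⊗[k] (M ⊗[k] k))) →ₗ[k] M ⊗[k] M :=
    LinearMap.lTensor M ((TensorProduct.rid k M).toLinearMap
      ∘ₗ (TensorProduct.lid k (M ⊗[k] k)).toLinearMap)
    ∘ₗ (TensorProduct.lid k _).toLinearMap
  have h : r ∘ₗ insTensor k M (1 : k) (1 : k) (1 : k) = LinearMap.id := by
    ext m₁ m₂
    simp [r]
  exact Function.LeftInverse.injective (g := r) fun t => LinearMap.congr_fun h t

/-- The linear map sending `m₁ ⊗ m₂ ⊗ m₃` to `u₁ ⊗ m₁ ⊗ u₂ ⊗ m₂ ⊗ u₃ ⊗ m₃ ⊗ u₄`. -/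
noncomputable def insTensorThree (k : Type u) [Field k] (M : Type u) [AddCommGroup M]
    [Module k M] [Module k U₁] [Module k U₂] [Module k U₃] [Module k U₄]
    (u₁ : U₁) (u₂ : U₂) (u₃ : U₃) (u₄ : U₄) :
    M ⊗[k] (M ⊗[k] M) →ₗ[k]
      U₁ ⊗[k] (M ⊗[k] (U₂ ⊗[k] (M ⊗[k] (U₃ ⊗[k] (M ⊗[k] U₄))))) :=
  TensorProduct.mk k U₁ _ u₁ ∘ₗ LinearMap.lTensor M (insTensor k M u₃ u₂ u₄)

@[simp]
theorem insTensorThree_tmul (u₁ : U₁) (u₂ : U₂) (u₃ : U₃) (u₄ : U₄) (m : M) (t : M ⊗[k] M) :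
    insTensorThree k M u₁ u₂ u₃ u₄ (m ⊗ₜ t) = u₁ ⊗ₜ (m ⊗ₜ insTensor k M u₃ u₂ u₄ t) := by
  simp [insTensorThree]

theorem insTensorThree_one_injective :
    Function.Injective (insTensorThree k M (1 : k) (1 : k) (1 : k) (1 : k)) :=
  (TensorProduct.lid k _).symm.injective.comp
    (Module.Flat.lTensor_preserves_injective_linearMap _ insTensor_one_injective)

theorem insTensorThree_assoc_tmul (u₁ : U₁) (u₂ : U₂) (u₃ : U₃) (u₄ : U₄)
    (t : M ⊗[k] M) (m : M) :
    insTensorThree k M u₁ u₂ u₃ u₄ (TensorProduct.assoc k M M M (t ⊗ₜ m)) =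
      insTensor k M u₂ u₁ (u₃ ⊗ₜ[k] (m ⊗ₜ[k] u₄)) t := by
  induction t with
  | zero => simp
  | tmul a b => simp
  | add a b ha hb => simp [TensorProduct.add_tmul, ha, hb]

/-- A map acting as `B₂₄ ∘ t₁₃` acts as `B₁₂` on the first two inserted factors. -/
theorem comp_insTensorThree_left (B : M ⊗[k] M →ₗ[k] M ⊗[k] M)
    {β : U₁ ⊗[k] (M ⊗[k] (U₂ ⊗[k] (M ⊗[k] (U₃ ⊗[k] (M ⊗[k] U₄))))) →ₗ[k]
      U₂ ⊗[k] (M ⊗[k] (U₁ ⊗[k] (M ⊗[k] (U₃ ⊗[k] (M ⊗[k] U₄)))))}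
    (hβ : ∀ u₁ u₂ u m₁ m₂, β (u₁ ⊗ₜ (m₁ ⊗ₜ (u₂ ⊗ₜ (m₂ ⊗ₜ u)))) =
      insTensor k M u₁ u₂ u (B (m₁ ⊗ₜ m₂)))
    (u₁ : U₁) (u₂ : U₂) (u₃ : U₃) (u₄ : U₄) :
    β ∘ₗ insTensorThree k M u₁ u₂ u₃ u₄ =
      insTensorThree k M u₂ u₁ u₃ u₄ ∘ₗ ((TensorProduct.assoc k M M M).toLinearMap
        ∘ₗ LinearMap.rTensor M B ∘ₗ (TensorProduct.assoc k M M M).symm.toLinearMap) := by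
  ext m₁ m₂ m₃
  simp [hβ, insTensorThree_assoc_tmul]

/-- A map acting as `B₂₄ ∘ t₁₃` acts as `B₂₃` on the last two inserted factors. -/
theorem lTensor_comp_insTensorThree (B : M ⊗[k] M →ₗ[k] M ⊗[k] M)
    {β : U₂ ⊗[k] (M ⊗[k] (U₃ ⊗[k] (M ⊗[k] U₄))) →ₗ[k]
      U₃ ⊗[k] (M ⊗[k] (U₂ ⊗[k] (M ⊗[k] U₄)))}
    (hβ : ∀ u₂ u₃ u₄ m₁ m₂, β (u₂ ⊗ₜ (m₁ ⊗ₜ (u₃ ⊗ₜ (m₂ ⊗ₜ u₄)))) =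
      insTensor k M u₂ u₃ u₄ (B (m₁ ⊗ₜ m₂)))
    (u₁ : U₁) (u₂ : U₂) (u₃ : U₃) (u₄ : U₄) :
    LinearMap.lTensor U₁ (LinearMap.lTensor M β) ∘ₗ insTensorThree k M u₁ u₂ u₃ u₄ =
      insTensorThree k M u₁ u₃ u₂ u₄ ∘ₗ LinearMap.lTensor M B := by
  ext m₁ m₂ m₃
  simp [hβ]

/-- Linear maps out of `U₁ ⊗ M ⊗ U₂ ⊗ M ⊗ U₃ ⊗ M ⊗ U₄` agree if they agree on insertions. -/
theorem ext_insTensorThree {P : Type*} [AddCommGroup P] [Module k P]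
    {f g : U₁ ⊗[k] (M ⊗[k] (U₂ ⊗[k] (M ⊗[k] (U₃ ⊗[k] (M ⊗[k] U₄))))) →ₗ[k] P}
    (h : ∀ u₁ u₂ u₃ u₄, f ∘ₗ insTensorThree k M u₁ u₂ u₃ u₄ =
      g ∘ₗ insTensorThree k M u₁ u₂ u₃ u₄) : f = g := by
  ext u₁ m₁ u₂ m₂ u₃ m₃ u₄
  simpa using LinearMap.congr_fun (h u₁ u₂ u₃ u₄) (m₁ ⊗ₜ (m₂ ⊗ₜ m₃))

end Insertion

/-- let `B` be a linear automorphism of `M ⊗ M` and let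
`β_{U₁,U₂,U₃} = B₂₄ ∘ t₁₃` (characterised on pure tensors by `hβ` below) be the
corresponding candidate b-structure on `(Vect_k, ⊗_M)` where
`U ⊗_M V := U ⊗ M ⊗ V`.  Then `β` satisfies the b-category coherence for all
vector spaces `X, Y, Z, W` if and only if `B` satisfies the hexagon (braid)
equation `B₁₂ B₂₃ B₁₂ = B₂₃ B₁₂ B₂₃` on `M ⊗ M ⊗ M`. -/
theorem bStructure_on_Vect_iff_yangBaxter (k : Type u) [Field k]
    (M : Type u) [AddCommGroup M] [Module k M]
    (B : (M ⊗[k] M) ≃ₗ[k] (M ⊗[k] M))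
    (β : ∀ (U₁ U₂ U₃ : Type u) [AddCommGroup U₁] [AddCommGroup U₂] [AddCommGroup U₃]
      [Module k U₁] [Module k U₂] [Module k U₃],
      U₁ ⊗[k] (M ⊗[k] (U₂ ⊗[k] (M ⊗[k] U₃)))
        →ₗ[k] U₂ ⊗[k] (M ⊗[k] (U₁ ⊗[k] (M ⊗[k] U₃))))
    (hβ : ∀ (U₁ U₂ U₃ : Type u) [AddCommGroup U₁] [AddCommGroup U₂] [AddCommGroup U₃]
      [Module k U₁] [Module k U₂] [Module k U₃]
      (u₁ : U₁) (u₂ : U₂) (u₃ : U₃) (m₁ m₂ : M),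
      β U₁ U₂ U₃ (u₁ ⊗ₜ (m₁ ⊗ₜ (u₂ ⊗ₜ (m₂ ⊗ₜ u₃))))
        = insTensor k M u₁ u₂ u₃ (B (m₁ ⊗ₜ m₂))) :
    (∀ (X Y Z W : Type u) [AddCommGroup X] [AddCommGroup Y] [AddCommGroup Z]
      [AddCommGroup W] [Module k X] [Module k Y] [Module k Z] [Module k W],
      LinearMap.lTensor Z (LinearMap.lTensor M (β X Y W))
          ∘ₗ β X Z (Y ⊗[k] (M ⊗[k] W))
          ∘ₗ LinearMap.lTensor X (LinearMap.lTensor M (β Y Z W))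
        = β Y Z (X ⊗[k] (M ⊗[k] W))
            ∘ₗ LinearMap.lTensor Y (LinearMap.lTensor M (β X Z W))
            ∘ₗ β X Y (Z ⊗[k] (M ⊗[k] W)))
      ↔ (((TensorProduct.assoc k M M M).toLinearMap
            ∘ₗ LinearMap.rTensor M B.toLinearMap
            ∘ₗ (TensorProduct.assoc k M M M).symm.toLinearMap)
          ∘ₗ LinearMap.lTensor M B.toLinearMap
          ∘ₗ ((TensorProduct.assoc k M M M).toLinearMap
            ∘ₗ LinearMap.rTensor M B.toLinearMap
            ∘ₗ (TensorProduct.assoc k M M M).symm.toLinearMap)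
        = LinearMap.lTensor M B.toLinearMap
          ∘ₗ ((TensorProduct.assoc k M M M).toLinearMap
            ∘ₗ LinearMap.rTensor M B.toLinearMap
            ∘ₗ (TensorProduct.assoc k M M M).symm.toLinearMap)
          ∘ₗ LinearMap.lTensor M B.toLinearMap) := by
  have hleft (X Y Z W : Type u) [AddCommGroup X] [AddCommGroup Y] [AddCommGroup Z]
      [AddCommGroup W] [Module k X] [Module k Y] [Module k Z] [Module k W]
      (x : X) (y : Y) (z : Z) (w : W) :=
    comp_insTensorThree_left B.toLinearMap (hβ X Y (Z ⊗[k] (M ⊗[k] W))) x y z w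
  have hright (X Y Z W : Type u) [AddCommGroup X] [AddCommGroup Y] [AddCommGroup Z]
      [AddCommGroup W] [Module k X] [Module k Y] [Module k Z] [Module k W]
      (x : X) (y : Y) (z : Z) (w : W) :=
    lTensor_comp_insTensorThree B.toLinearMap (hβ Y Z W) x y z w
  set B₁₂ := (TensorProduct.assoc k M M M).toLinearMap ∘ₗ LinearMap.rTensor M B.toLinearMap
    ∘ₗ (TensorProduct.assoc k M M M).symm.toLinearMap
  set B₂₃ := LinearMap.lTensor M B.toLinearMap
  have hl (X Y Z W : Type u) [AddCommGroup X] [AddCommGroup Y] [AddCommGroup Z]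
      [AddCommGroup W] [Module k X] [Module k Y] [Module k Z] [Module k W]
      (x : X) (y : Y) (z : Z) (w : W) :
      (LinearMap.lTensor Z (LinearMap.lTensor M (β X Y W))
          ∘ₗ β X Z (Y ⊗[k] (M ⊗[k] W))
          ∘ₗ LinearMap.lTensor X (LinearMap.lTensor M (β Y Z W)))
        ∘ₗ insTensorThree k M x y z w =
      insTensorThree k M z y x w ∘ₗ B₂₃ ∘ₗ B₁₂ ∘ₗ B₂₃ := by
    rw [LinearMap.comp_assoc, LinearMap.comp_assoc, hright,
      ← LinearMap.comp_assoc _ (insTensorThree k M x z y w), hleft, LinearMap.comp_assoc,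
      ← LinearMap.comp_assoc, hright, LinearMap.comp_assoc]
  have hr (X Y Z W : Type u) [AddCommGroup X] [AddCommGroup Y] [AddCommGroup Z]
      [AddCommGroup W] [Module k X] [Module k Y] [Module k Z] [Module k W]
      (x : X) (y : Y) (z : Z) (w : W) :
      (β Y Z (X ⊗[k] (M ⊗[k] W))
          ∘ₗ LinearMap.lTensor Y (LinearMap.lTensor M (β X Z W))
          ∘ₗ β X Y (Z ⊗[k] (M ⊗[k] W)))
        ∘ₗ insTensorThree k M x y z w =
      insTensorThree k M z y x w ∘ₗ B₁₂ ∘ₗ B₂₃ ∘ₗ B₁₂ := by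
    rw [LinearMap.comp_assoc, LinearMap.comp_assoc, hleft,
      ← LinearMap.comp_assoc _ (insTensorThree k M y x z w), hright, LinearMap.comp_assoc,
      ← LinearMap.comp_assoc, hleft, LinearMap.comp_assoc]
  constructor
  · intro h
    refine LinearMap.ext fun t => insTensorThree_one_injective ?_
    have h₁ := hl k k k k 1 1 1 1
    rw [h k k k k, hr k k k k] at h₁
    exact LinearMap.congr_fun h₁ t
  · intro h X Y Z W _ _ _ _ _ _ _ _
    refine ext_insTensorThree fun x y z w => ?_
    rw [hl, hr, h]
end

section
/- Let E be a monoidal category, let B be an object of E equipped with a half-braiding t (i.e. (B,t) is an object of the Drinfeld centre of E) such that t_{B,B} ∘ t_{B,B} = id_{B⊗B}, and let Z : B^{⊗3} → B^{⊗3} be a morphism. On B^{⊗6} write σ_i (i = 1,…,5) for the instance of t_{B,B} acting on the i-th and (i+1)-st tensor factors, write S_{i,i+1,i+2} for S acting on three consecutive factors starting at position i, and for a general index triple define Z_{ijk} := P^{-1} ∘ (Z ⊗ 1^{⊗3}) ∘ P, where P is the composite of σ's implementing the permutation of tensor factors that moves factors i, j, k to positions 1, 2, 3 (preserving the order of the remaining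 factors). Set S := σ_1 ∘ σ_2 ∘ σ_1 ∘ Z. Then S satisfies the coherence equation σ_3 S_{456} S_{234} (σ_1 σ_4) S_{234} S_{456} = S_{123} S_{345} (σ_2 σ_5) S_{345} S_{123} σ_3 in End(B^{⊗6}) if and only if Z satisfies Zamolodchikov's tetrahedron equation Z_{124} Z_{135} Z_{236} Z_{456} = Z_{456} Z_{236} Z_{135} Z_{124} in End(B^{⊗6}). -/
open CategoryTheory MonoidalCategory

universe v u

namespace ZamolodchikovStmt

variable {E : Type u} [Category.{v} E] [MonoidalCategory E]

/-- `B^{⊗2}` (right-nested). -/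
def t2 (B : E) : E := B ⊗ B
/-- `B^{⊗3}` (right-nested). -/
def t3 (B : E) : E := B ⊗ t2 B
/-- `B^{⊗4}` (right-nested). -/
def t4 (B : E) : E := B ⊗ t3 B
/-- `B^{⊗5}` (right-nested). -/
def t5 (B : E) : E := B ⊗ t4 B
/-- `B^{⊗6}` (right-nested). -/
def t6 (B : E) : E := B ⊗ t5 B

/-- Conjugating an endomorphism of `B ⊗ B` onto the first two factors of a
right-nested tensor product `B ⊗ (B ⊗ R)`: this is `f ⊗ 1_R`. -/
def conj2 (B R : E) (f : t2 B ⟶ t2 B) : B ⊗ (B ⊗ R) ⟶ B ⊗ (B ⊗ R) :=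
  (α_ B B R).inv ≫ (f ▷ R) ≫ (α_ B B R).hom

/-- The structural isomorphism `(B⊗(B⊗B)) ⊗ R ≅ B⊗(B⊗(B⊗R))`. -/
def assoc3 (B R : E) : t3 B ⊗ R ≅ B ⊗ (B ⊗ (B ⊗ R)) :=
  α_ B (t2 B) R ≪≫ whiskerLeftIso B (α_ B B R)

/-- Conjugating an endomorphism `S` of `B^{⊗3}` onto the first three factors of a
right-nested tensor product `B ⊗ (B ⊗ (B ⊗ R))`: this is `S ⊗ 1_R`. -/
def conj3 (B R : E) (S : t3 B ⟶ t3 B) :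
    B ⊗ (B ⊗ (B ⊗ R)) ⟶ B ⊗ (B ⊗ (B ⊗ R)) :=
  (assoc3 B R).inv ≫ (S ▷ R) ≫ (assoc3 B R).hom

section Six

variable (B : E) (f : t2 B ⟶ t2 B)

/-- `σ₁` on `B^{⊗6}` (with `f` a given endomorphism of `B ⊗ B`, e.g. `t_{B,B}`). -/
def sig1 : t6 B ⟶ t6 B := conj2 B (t4 B) f

/-- `σ₂` on `B^{⊗6}`. -/
def sig2 : t6 B ⟶ t6 B := B ◁ conj2 B (t3 B) f

/-- `σ₃` on `B^{⊗6}`. -/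
def sig3 : t6 B ⟶ t6 B := B ◁ (B ◁ conj2 B (t2 B) f)

/-- `σ₄` on `B^{⊗6}`. -/
def sig4 : t6 B ⟶ t6 B := B ◁ (B ◁ (B ◁ conj2 B B f))

/-- `σ₅` on `B^{⊗6}`. -/
def sig5 : t6 B ⟶ t6 B := B ◁ (B ◁ (B ◁ (B ◁ f)))

variable (S : t3 B ⟶ t3 B)

/-- `S` acting on the three consecutive factors `1,2,3` of `B^{⊗6}`. -/
def pl123 : t6 B ⟶ t6 B := conj3 B (t3 B) S

/-- `S` acting on the three consecutive factors `2,3,4` of `B^{⊗6}`. -/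
def pl234 : t6 B ⟶ t6 B := B ◁ conj3 B (t2 B) S

/-- `S` acting on the three consecutive factors `3,4,5` of `B^{⊗6}`. -/
def pl345 : t6 B ⟶ t6 B := B ◁ (B ◁ conj3 B B S)

/-- `S` acting on the three consecutive factors `4,5,6` of `B^{⊗6}`. -/
def pl456 : t6 B ⟶ t6 B := B ◁ (B ◁ (B ◁ S))

end Six

section Zplacements

variable (B : E) (τ τ' : t2 B ⟶ t2 B) (Z : t3 B ⟶ t3 B)

/-- `Z_{124} = P⁻¹ ∘ (Z ⊗ 1^{⊗3}) ∘ P` with `P = σ₃` (the word in the `σᵢ`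
moving factors `1,2,4` to positions `1,2,3` and preserving the order of the
remaining factors); `τ'` denotes the inverse of the half-braiding `τ`. -/
def z124 : t6 B ⟶ t6 B := sig3 B τ ≫ pl123 B Z ≫ sig3 B τ'

/-- `Z_{135} = P⁻¹ ∘ (Z ⊗ 1^{⊗3}) ∘ P` with `P = σ₃ ∘ σ₄ ∘ σ₂`. -/
def z135 : t6 B ⟶ t6 B :=
  (sig2 B τ ≫ sig4 B τ ≫ sig3 B τ) ≫ pl123 B Z
    ≫ (sig3 B τ' ≫ sig4 B τ' ≫ sig2 B τ')

/-- `Z_{236} = P⁻¹ ∘ (Z ⊗ 1^{⊗3}) ∘ P` with `P = σ₃ ∘ σ₂ ∘ σ₁ ∘ σ₄ ∘ σ₅`. -/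
def z236 : t6 B ⟶ t6 B :=
  (sig5 B τ ≫ sig4 B τ ≫ sig1 B τ ≫ sig2 B τ ≫ sig3 B τ) ≫ pl123 B Z
    ≫ (sig3 B τ' ≫ sig2 B τ' ≫ sig1 B τ' ≫ sig4 B τ' ≫ sig5 B τ')

/-- `Z_{456}`: `Z` acting on the (consecutive) factors `4,5,6`. -/
def z456 : t6 B ⟶ t6 B := pl456 B Z

end Zplacements

section HalfBraiding

variable {B : E}

/-- The form of `conj2` whose type does not mention `t2`. -/
def onFirstTwo (f : B ⊗ B ⟶ B ⊗ B) (R : E) : B ⊗ B ⊗ R ⟶ B ⊗ B ⊗ R :=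
  (α_ B B R).inv ≫ f ▷ R ≫ (α_ B B R).hom

/-- The form of `conj3` whose type does not mention `t3`. -/
def onFirstThree (Z : B ⊗ B ⊗ B ⟶ B ⊗ B ⊗ B) (R : E) : B ⊗ B ⊗ B ⊗ R ⟶ B ⊗ B ⊗ B ⊗ R :=
  (B ◁ (α_ B B R).inv ≫ (α_ B (B ⊗ B) R).inv) ≫ Z ▷ R ≫
    (α_ B (B ⊗ B) R).hom ≫ B ◁ (α_ B B R).hom

/-- An endomorphism of `B^{⊗4}` acting on the first four factors. -/
def onFirstFour (g : B ⊗ B ⊗ B ⊗ B ⟶ B ⊗ B ⊗ B ⊗ B) (R : E) :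
    B ⊗ B ⊗ B ⊗ B ⊗ R ⟶ B ⊗ B ⊗ B ⊗ B ⊗ R :=
  (B ◁ (B ◁ (α_ B B R).inv ≫ (α_ B (B ⊗ B) R).inv) ≫ (α_ B (B ⊗ B ⊗ B) R).inv) ≫ g ▷ R ≫
    (α_ B (B ⊗ B ⊗ B) R).hom ≫ B ◁ ((α_ B (B ⊗ B) R).hom ≫ B ◁ (α_ B B R).hom)

theorem onFirstTwo_comp_self {f : B ⊗ B ⟶ B ⊗ B} (hf : f ≫ f = 𝟙 (B ⊗ B)) (R : E) :
    onFirstTwo f R ≫ onFirstTwo f R = 𝟙 (B ⊗ B ⊗ R) := by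
  have h : f ▷ R ≫ f ▷ R = 𝟙 _ := by rw [← comp_whiskerRight, hf, id_whiskerRight]
  simp [onFirstTwo, reassoc_of% h]

theorem onFirstTwo_naturality (f : B ⊗ B ⟶ B ⊗ B) {R R' : E} (g : R ⟶ R') :
    onFirstTwo f R ≫ B ◁ B ◁ g = B ◁ B ◁ g ≫ onFirstTwo f R' := by
  have h := whisker_exchange f g
  calc _ = (α_ B B R).inv ≫ (f ▷ R ≫ (B ⊗ B) ◁ g) ≫ (α_ B B R').hom := by
        dsimp only [onFirstTwo]; monoidal
    _ = _ := by rw [← h]; dsimp only [onFirstTwo]; monoidal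

theorem onFirstThree_naturality (Z : B ⊗ B ⊗ B ⟶ B ⊗ B ⊗ B) {R R' : E} (g : R ⟶ R') :
    onFirstThree Z R ≫ B ◁ B ◁ B ◁ g = B ◁ B ◁ B ◁ g ≫ onFirstThree Z R' := by
  have h := whisker_exchange Z g
  calc _ = (B ◁ (α_ B B R).inv ≫ (α_ B (B ⊗ B) R).inv) ≫ (Z ▷ R ≫ (B ⊗ B ⊗ B) ◁ g) ≫
        (α_ B (B ⊗ B) R').hom ≫ B ◁ (α_ B B R').hom := by
        dsimp only [onFirstThree]; monoidal
    _ = _ := by rw [← h]; dsimp only [onFirstThree]; monoidal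

theorem onFirstThree_comp (Z Z' : B ⊗ B ⊗ B ⟶ B ⊗ B ⊗ B) (R : E) :
    onFirstThree (Z ≫ Z') R = onFirstThree Z R ≫ onFirstThree Z' R := by
  simp [onFirstThree]

/-- The longest permutation of three factors, composed with `Z`, acting on the first three of the
factors. -/
theorem onFirstThree_reverse (f : B ⊗ B ⟶ B ⊗ B) (Z : B ⊗ B ⊗ B ⟶ B ⊗ B ⊗ B) (R : E) :
    onFirstThree (Z ≫ onFirstTwo f B ≫ B ◁ f ≫ onFirstTwo f B) R =
      onFirstThree Z R ≫ onFirstTwo f (B ⊗ R) ≫ B ◁ onFirstTwo f R ≫ onFirstTwo f (B ⊗ R) := by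
  have h₁ : onFirstThree (onFirstTwo f B) R = onFirstTwo f (B ⊗ R) := by
    dsimp only [onFirstThree, onFirstTwo]; monoidal
  have h₂ : onFirstThree (B ◁ f) R = B ◁ onFirstTwo f R := by
    dsimp only [onFirstThree, onFirstTwo]; monoidal
  simp only [onFirstThree_comp, h₁, h₂]

theorem yang_baxter (β : HalfBraiding B) :
    onFirstTwo (β.β B).hom B ≫ B ◁ (β.β B).hom ≫ onFirstTwo (β.β B).hom B =
      B ◁ (β.β B).hom ≫ onFirstTwo (β.β B).hom B ≫ B ◁ (β.β B).hom := by
  have h := β.naturality (β.β B).hom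
  rw [β.monoidal, ← cancel_mono (α_ B B B).hom] at h
  simpa [onFirstTwo] using h.symm

theorem yang_baxter_tensor (β : HalfBraiding B) (R : E) :
    onFirstTwo (β.β B).hom (B ⊗ R) ≫ B ◁ onFirstTwo (β.β B).hom R ≫
        onFirstTwo (β.β B).hom (B ⊗ R) =
      B ◁ onFirstTwo (β.β B).hom R ≫ onFirstTwo (β.β B).hom (B ⊗ R) ≫
        B ◁ onFirstTwo (β.β B).hom R := by
  have h := congrArg (onFirstThree · R) (yang_baxter β)
  dsimp only [onFirstTwo, onFirstThree] at *
  convert h using 1 <;> monoidal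

/-- Moving a strand across `Z` from left to right translates `Z` by one factor. -/
theorem translate (β : HalfBraiding B) (Z : B ⊗ B ⊗ B ⟶ B ⊗ B ⊗ B) :
    B ◁ Z ≫ onFirstTwo (β.β B).hom (B ⊗ B) ≫ B ◁ onFirstTwo (β.β B).hom B ≫
        B ◁ B ◁ (β.β B).hom =
      (onFirstTwo (β.β B).hom (B ⊗ B) ≫ B ◁ onFirstTwo (β.β B).hom B ≫
        B ◁ B ◁ (β.β B).hom) ≫ onFirstThree Z B := by
  have hβ : onFirstTwo (β.β B).hom (B ⊗ B) ≫ B ◁ onFirstTwo (β.β B).hom B ≫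
      B ◁ B ◁ (β.β B).hom = (β.β (B ⊗ B ⊗ B)).hom ≫
        (α_ B (B ⊗ B) B).hom ≫ B ◁ (α_ B B B).hom := by
    rw [β.monoidal, β.monoidal]
    dsimp only [onFirstTwo]
    monoidal
  rw [hβ, β.naturality_assoc]
  simp [onFirstThree, -HalfBraiding.monoidal]

theorem translate_tensor (β : HalfBraiding B) (Z : B ⊗ B ⊗ B ⟶ B ⊗ B ⊗ B) (R : E) :
    B ◁ onFirstThree Z R ≫ onFirstTwo (β.β B).hom (B ⊗ B ⊗ R) ≫
        B ◁ onFirstTwo (β.β B).hom (B ⊗ R) ≫ B ◁ B ◁ onFirstTwo (β.β B).hom R =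
      (onFirstTwo (β.β B).hom (B ⊗ B ⊗ R) ≫ B ◁ onFirstTwo (β.β B).hom (B ⊗ R) ≫
        B ◁ B ◁ onFirstTwo (β.β B).hom R) ≫ onFirstThree Z (B ⊗ R) := by
  have h := congrArg (onFirstFour · R) (translate β Z)
  dsimp only [onFirstTwo, onFirstThree, onFirstFour] at *
  convert h using 1 <;> monoidal

end HalfBraiding

/-- In a monoid with elements `s1, …, s5` satisfying the Coxeter relations of `S₆`, let `a` commute
with `s4` and `s5`, and let `b`, `c`, `d` be its conjugates moved to the later triples of consecutive
factors. Both sides of the coherence equation are the longest word `w` times the corresponding sides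
of the tetrahedron equation. -/
theorem coherence_iff_tetrahedron {M : Type*} [Monoid M] (s1 s2 s3 s4 s5 a b c d : M)
    (h11 : s1 * s1 = 1) (h22 : s2 * s2 = 1) (h33 : s3 * s3 = 1) (h44 : s4 * s4 = 1)
    (h55 : s5 * s5 = 1)
    (h13 : s1 * s3 = s3 * s1) (h14 : s1 * s4 = s4 * s1) (h15 : s1 * s5 = s5 * s1)
    (h24 : s2 * s4 = s4 * s2) (h25 : s2 * s5 = s5 * s2) (h35 : s3 * s5 = s5 * s3)
    (h12 : s1 * s2 * s1 = s2 * s1 * s2) (h23 : s2 * s3 * s2 = s3 * s2 * s3)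
    (h34 : s3 * s4 * s3 = s4 * s3 * s4) (h45 : s4 * s5 * s4 = s5 * s4 * s5)
    (ha4 : a * s4 = s4 * a) (ha5 : a * s5 = s5 * a)
    (hb : s3 * s2 * s1 * b = a * (s3 * s2 * s1))
    (hc : s4 * s3 * s2 * c = b * (s4 * s3 * s2))
    (hd : s5 * s4 * s3 * d = c * (s5 * s4 * s3)) :
    (s3 * (s4 * s5 * s4 * d) * (s2 * s3 * s2 * b) * s1 * s4 * (s2 * s3 * s2 * b)
        * (s4 * s5 * s4 * d) =
      s1 * s2 * s1 * a * (s3 * s4 * s3 * c) * s2 * s5 * (s3 * s4 * s3 * c)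
        * (s1 * s2 * s1 * a) * s3) ↔
    s3 * a * s3 * (s2 * s4 * s3 * a * (s3 * s4 * s2)) *
        (s5 * s4 * s1 * s2 * s3 * a * (s3 * s2 * s1 * s4 * s5)) * d =
      d * (s5 * s4 * s1 * s2 * s3 * a * (s3 * s2 * s1 * s4 * s5)) *
        (s2 * s4 * s3 * a * (s3 * s4 * s2)) * (s3 * a * s3) := by
  have cons {x y z : M} (h : x * y = z) (v : M) : x * (y * v) = z * v := by
    rw [← mul_assoc, h]
  have cons₃ {x y z w : M} (h : x * y * z = w) (v : M) : x * (y * (z * v)) = w * v := by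
    rw [← h]; simp only [mul_assoc]
  have hb' : b = s1 * s2 * s3 * a * (s3 * s2 * s1) := by
    rw [mul_assoc _ a, ← hb]; simp only [mul_assoc, cons h11, cons h22, cons h33, one_mul]
  have hc' : c = s2 * s3 * s4 * b * (s4 * s3 * s2) := by
    rw [mul_assoc _ b, ← hc]; simp only [mul_assoc, cons h22, cons h33, cons h44, one_mul]
  have hd' : d = s3 * s4 * s5 * c * (s5 * s4 * s3) := by
    rw [mul_assoc _ c, ← hd]; simp only [mul_assoc, cons h33, cons h44, cons h55, one_mul]
  have h13_2 (v : M) : s1 * (s2 * (s3 * (s1 * v))) = s2 * (s1 * (s2 * (s3 * v))) := by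
    simpa [mul_assoc, cons h13] using cons₃ h12 (s3 * v)
  have h24_2 (v : M) : s2 * (s3 * (s4 * (s2 * v))) = s3 * (s2 * (s3 * (s4 * v))) := by
    simpa [mul_assoc, cons h24] using cons₃ h23 (s4 * v)
  have h35_2 (v : M) : s3 * (s4 * (s5 * (s3 * v))) = s4 * (s3 * (s4 * (s5 * v))) := by
    simpa [mul_assoc, cons h35] using cons₃ h34 (s5 * v)
  have h14_2 (v : M) :
      s1 * (s2 * (s3 * (s4 * (s1 * v)))) = s2 * (s1 * (s2 * (s3 * (s4 * v)))) := by
    simpa [mul_assoc, cons h14] using h13_2 (s4 * v)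
  have h25_2 (v : M) :
      s2 * (s3 * (s4 * (s5 * (s2 * v)))) = s3 * (s2 * (s3 * (s4 * (s5 * v)))) := by
    simpa [mul_assoc, cons h25] using h24_2 (s5 * v)
  have h15_2 (v : M) :
      s1 * (s2 * (s3 * (s4 * (s5 * (s1 * v))))) =
        s2 * (s1 * (s2 * (s3 * (s4 * (s5 * v))))) := by
    simpa [mul_assoc, cons h15] using h14_2 (s5 * v)
  set w := s1 * s2 * s3 * s4 * s5 * s1 * s2 * s3 * s4 * s1 * s2 * s3 * s1 * s2 * s1 with hw
  have hww : w * w = 1 := by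
    rw [← mul_one (w * w), hw]
    simp only [mul_assoc, cons h11, cons h22, cons h33, cons h44, cons h55, cons h13, cons h14,
      cons h15, cons h24, cons h25, cons h35, cons₃ h12, cons₃ h23, cons₃ h34, cons₃ h45, h35_2, h25_2,
      h15_2, one_mul]
  have reduce_left (v : M) :
      s3 * (s4 * s5 * s4 * d) * (s2 * s3 * s2 * b) * s1 * s4 * (s2 * s3 * s2 * b)
        * (s4 * s5 * s4 * d) * v =
      w * (s3 * a * s3 * (s2 * s4 * s3 * a * (s3 * s4 * s2)) *
        (s5 * s4 * s1 * s2 * s3 * a * (s3 * s2 * s1 * s4 * s5)) * d) * v := by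
    simp only [hw, hd', hc', hb',
      mul_assoc, cons h11, cons h22, cons h33, cons h44, cons h55, cons h13, cons h14,
      cons h15, cons h24, cons h25, cons h35, cons₃ h23, cons₃ h34, cons₃ h45, h24_2,
      h35_2, h14_2, h25_2, h15_2, cons ha4, cons ha5, one_mul]
  have reduce_right (v : M) :
      s1 * s2 * s1 * a * (s3 * s4 * s3 * c) * s2 * s5 * (s3 * s4 * s3 * c)
        * (s1 * s2 * s1 * a) * s3 * v =
      w * (d * (s5 * s4 * s1 * s2 * s3 * a * (s3 * s2 * s1 * s4 * s5)) *
        (s2 * s4 * s3 * a * (s3 * s4 * s2)) * (s3 * a * s3)) * v := by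
    simp only [hw, hd', hc', hb',
      mul_assoc, cons h11, cons h22, cons h33, cons h44, cons h55, cons h13, cons h14,
      cons h15, cons h24, cons h25, cons h35, cons₃ h12, cons₃ h23, cons₃ h34, cons₃ h45, h13_2, h24_2,
      h35_2, h14_2, h25_2, h15_2, cons ha4, cons ha5, one_mul]
  rw [← mul_one (s3 * _ * _ * _ * _ * _ * _), reduce_left 1, mul_one,
    ← mul_one (s1 * s2 * _ * _ * _ * _ * _ * _ * _ * _), reduce_right 1, mul_one]
  refine ⟨fun h => ?_, fun h => by rw [h]⟩
  simpa only [← mul_assoc w w, hww, one_mul] using congrArg (w * ·) h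

/-- Theorem `oobb`: let `(B, t)` be an object of the Drinfeld
centre of a monoidal category `E` whose half-braiding is symmetric at `B`
(`t_{B,B} ∘ t_{B,B} = id`), and let `Z : B^{⊗3} → B^{⊗3}`.  Writing `τ = t_{B,B}`,
`σᵢ` for its instances on `B^{⊗6}` and setting `S := σ₁ ∘ σ₂ ∘ σ₁ ∘ Z` on `B^{⊗3}`
(here `σ₁ = conj2 B B τ` and `σ₂ = B ◁ τ` are the instances of `τ` on `B^{⊗3}`),
the coherence equation
`σ₃ S₄₅₆ S₂₃₄ (σ₁σ₄) S₂₃₄ S₄₅₆ = S₁₂₃ S₃₄₅ (σ₂σ₅) S₃₄₅ S₁₂₃ σ₃`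
holds in `End(B^{⊗6})` if and only if `Z` satisfies Zamolodchikov's tetrahedron
equation `Z₁₂₄ Z₁₃₅ Z₂₃₆ Z₄₅₆ = Z₄₅₆ Z₂₃₆ Z₁₃₅ Z₁₂₄` in `End(B^{⊗6})`.
(Juxtaposition is composition applying the rightmost operator first, so it is
rendered by `≫` in the reverse order.) -/
theorem one_object_bBicategory_iff_tetrahedron
    (Bc : Center E)
    (hτ : (Bc.2.β Bc.1).hom ≫ (Bc.2.β Bc.1).hom = 𝟙 (t2 Bc.1))
    (Z : t3 Bc.1 ⟶ t3 Bc.1)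
    (S : t3 Bc.1 ⟶ t3 Bc.1)
    (hS : S = Z ≫ conj2 Bc.1 Bc.1 (Bc.2.β Bc.1).hom ≫ (Bc.1 ◁ (Bc.2.β Bc.1).hom)
      ≫ conj2 Bc.1 Bc.1 (Bc.2.β Bc.1).hom) :
    (pl456 Bc.1 S ≫ pl234 Bc.1 S ≫ sig4 Bc.1 (Bc.2.β Bc.1).hom
        ≫ sig1 Bc.1 (Bc.2.β Bc.1).hom ≫ pl234 Bc.1 S ≫ pl456 Bc.1 S
        ≫ sig3 Bc.1 (Bc.2.β Bc.1).hom
      = sig3 Bc.1 (Bc.2.β Bc.1).hom ≫ pl123 Bc.1 S ≫ pl345 Bc.1 S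
        ≫ sig5 Bc.1 (Bc.2.β Bc.1).hom ≫ sig2 Bc.1 (Bc.2.β Bc.1).hom
        ≫ pl345 Bc.1 S ≫ pl123 Bc.1 S)
    ↔ (z456 Bc.1 Z ≫ z236 Bc.1 (Bc.2.β Bc.1).hom (Bc.2.β Bc.1).inv Z
          ≫ z135 Bc.1 (Bc.2.β Bc.1).hom (Bc.2.β Bc.1).inv Z
          ≫ z124 Bc.1 (Bc.2.β Bc.1).hom (Bc.2.β Bc.1).inv Z
        = z124 Bc.1 (Bc.2.β Bc.1).hom (Bc.2.β Bc.1).inv Z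
          ≫ z135 Bc.1 (Bc.2.β Bc.1).hom (Bc.2.β Bc.1).inv Z
          ≫ z236 Bc.1 (Bc.2.β Bc.1).hom (Bc.2.β Bc.1).inv Z ≫ z456 Bc.1 Z) := by
  obtain ⟨B, β⟩ := Bc
  let τ : B ⊗ B ⟶ B ⊗ B := (β.β B).hom
  let Y : B ⊗ B ⊗ B ⟶ B ⊗ B ⊗ B := Z
  have hinv : (β.β B).inv = (β.β B).hom := by
    rw [← cancel_epi (β.β B).hom, Iso.hom_inv_id]; exact hτ.symm
  have whisker {X : E} {f g : X ⟶ X} (h : f = g) : B ◁ f = B ◁ g := by rw [h]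
  have whisker_one {X : E} {f g : X ⟶ X} (h : f ≫ g = 𝟙 X) : B ◁ f ≫ B ◁ g = 𝟙 (B ⊗ X) := by
    rw [← whiskerLeft_comp, h, whiskerLeft_id]
  have whisker_two {X : E} {f g f' g' : X ⟶ X} (h : f ≫ g = f' ≫ g') :
      B ◁ f ≫ B ◁ g = B ◁ f' ≫ B ◁ g' := by
    simpa only [whiskerLeft_comp] using whisker h
  have whisker_three {X : E} {f g h f' g' h' : X ⟶ X} (e : f ≫ g ≫ h = f' ≫ g' ≫ h') :
      B ◁ f ≫ B ◁ g ≫ B ◁ h = B ◁ f' ≫ B ◁ g' ≫ B ◁ h' := by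
    simpa only [whiskerLeft_comp] using whisker e
  have whisker_four {X : E} {f g h k f' g' h' k' : X ⟶ X}
      (e : f ≫ g ≫ h ≫ k = (f' ≫ g' ≫ h') ≫ k') :
      B ◁ f ≫ B ◁ g ≫ B ◁ h ≫ B ◁ k = (B ◁ f' ≫ B ◁ g' ≫ B ◁ h') ≫ B ◁ k' := by
    simpa only [whiskerLeft_comp] using whisker e
  have whisker_reverse {X : E} {p f g h k : X ⟶ X} (e : p = f ≫ g ≫ h ≫ k) :
      B ◁ p = B ◁ f ≫ B ◁ g ≫ B ◁ h ≫ B ◁ k := by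
    simpa only [whiskerLeft_comp] using whisker e
  have sq (R : E) : onFirstTwo τ R ≫ onFirstTwo τ R = 𝟙 (B ⊗ B ⊗ R) := onFirstTwo_comp_self hτ R
  have key := coherence_iff_tetrahedron (M := End (t6 B)) (sig1 B τ) (sig2 B τ) (sig3 B τ)
    (sig4 B τ) (sig5 B τ) (pl123 B Z) (pl234 B Z) (pl345 B Z) (pl456 B Z)
    (sq _) (whisker_one (sq _)) (whisker_one (whisker_one (sq _)))
    (whisker_one (whisker_one (whisker_one (sq _))))
    (whisker_one (whisker_one (whisker_one (whisker_one hτ))))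
    (onFirstTwo_naturality τ (onFirstTwo τ (B ⊗ B))).symm
    (onFirstTwo_naturality τ (B ◁ onFirstTwo τ B)).symm
    (onFirstTwo_naturality τ (B ◁ B ◁ τ)).symm
    (whisker_two (onFirstTwo_naturality τ (onFirstTwo τ B)).symm)
    (whisker_two (onFirstTwo_naturality τ (B ◁ τ)).symm)
    (whisker_two (whisker_two (onFirstTwo_naturality τ τ).symm))
    (yang_baxter_tensor β _)
    (whisker_three (yang_baxter_tensor β _))
    (whisker_three (whisker_three (yang_baxter_tensor β _)))
    (whisker_three (whisker_three (whisker_three (yang_baxter β))))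
    (onFirstThree_naturality Y (onFirstTwo τ B)).symm
    (onFirstThree_naturality Y (B ◁ τ)).symm
    (translate_tensor β Y (B ⊗ B))
    (whisker_four (translate_tensor β Y B))
    (whisker_four (whisker_four (translate β Y)))
  have h123 : pl123 B S = pl123 B Z ≫ sig1 B τ ≫ sig2 B τ ≫ sig1 B τ := by
    rw [hS]
    exact onFirstThree_reverse τ Y _
  have h234 : pl234 B S = pl234 B Z ≫ sig2 B τ ≫ sig3 B τ ≫ sig2 B τ := by
    rw [hS]
    exact whisker_reverse (onFirstThree_reverse τ Y _)
  have h345 : pl345 B S = pl345 B Z ≫ sig3 B τ ≫ sig4 B τ ≫ sig3 B τ := by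
    rw [hS]
    exact whisker_reverse (whisker_reverse (onFirstThree_reverse τ Y _))
  have h456 : pl456 B S = pl456 B Z ≫ sig4 B τ ≫ sig5 B τ ≫ sig4 B τ := by
    rw [hS]
    exact whisker_reverse (whisker_reverse (whisker_reverse rfl))
  dsimp only
  rw [h123, h234, h345, h456, hinv]
  exact key

end ZamolodchikovStmt
end
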